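/- For c ≥ 2, there are infinitely many distinct Inc(ℕ)-compatible term orders on R. More precisely, for each term order ⪯' on K[x_{1,1},...,x_{c,1}], the relation defined on monomials of R by x₁^{a(1)}···x_n^{a(n)} ≺ x₁^{b(1)}···x_n^{b(n)} :⇔ x₁^{a(i)} ≺' x₁^{b(i)} for i = min{j | a(j) ≠ b(j)} (where a(i), b(i) ∈ ℕ₀^c and x_i^{a(i)} := x_{1,i}^{a(i)_1}···x_{c,i}^{a(i)_c}) is an Inc(ℕ)-compatible term order on R, and distinct term orders ⪯'₁ ≠ ⪯'₂ on K[x_{1,1},...,x_{c,1}] yield distinct term orders on R. -/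

import Mathlib

/-- A term order: a total order on monomials (identified with their exponent vectors, so
that multiplication of monomials becomes addition of exponent vectors) which respects
multiplication and has the monomial `1` (exponent vector `0`) as least element. -/
structure TermOrder (σ : Type*) where
  le : (σ →₀ ℕ) → (σ →₀ ℕ) → Prop
  refl : ∀ a, le a a
  trans : ∀ a b c, le a b → le b c → le a c
  antisymm : ∀ a b, le a b → le b a → a = b
  total : ∀ a b, le a b ∨ le b a
  add_right : ∀ a b h, le a b → le (a + h) (b + h)
  zero_le : ∀ a, le 0 a

/-- The action of `p : ℕ → ℕ` on variable indices: `x_{i,j} ↦ x_{i,p(j)}`. -/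
def incVar (c : ℕ) (p : ℕ → ℕ) : Fin c × ℕ → Fin c × ℕ := fun v => (v.1, p v.2)

/-- A term order on `R = K[x_{i,j} | i ∈ [c], j ∈ ℕ]` (monomials being exponent vectors in
`(Fin c × ℕ) →₀ ℕ`) is `Inc(ℕ)`-compatible if it is preserved by the action of every
strictly increasing map. -/
def IncCompatible (c : ℕ) (T : TermOrder (Fin c × ℕ)) : Prop :=
  ∀ p : ℕ → ℕ, StrictMono p → ∀ a b, T.le a b →
    T.le (Finsupp.mapDomain (incVar c p) a) (Finsupp.mapDomain (incVar c p) b)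

/-- The `i`-th "slice" `a(i) ∈ ℕ₀^c` of a monomial `x₁^{a(1)} ⋯ x_n^{a(n)}` of `R`:
the exponents of the variables `x_{1,i}, ..., x_{c,i}`. -/
noncomputable def sliceAt (c : ℕ) (a : (Fin c × ℕ) →₀ ℕ) (i : ℕ) : Fin c →₀ ℕ :=
  Finsupp.comapDomain (fun k : Fin c => (k, i)) a (by
    intro x _ y _ h
    simpa using congrArg Prod.fst h)

/-- The strict order on monomials of `R` obtained from a term order `⪯'` on
`K[x_{1,1},...,x_{c,1}]`: `x₁^{a(1)}⋯x_n^{a(n)} ≺ x₁^{b(1)}⋯x_n^{b(n)}` iff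
`x₁^{a(i)} ≺' x₁^{b(i)}` for `i = min{j | a(j) ≠ b(j)}`. -/
def liftLt (c : ℕ) (T' : TermOrder (Fin c)) :
    ((Fin c × ℕ) →₀ ℕ) → ((Fin c × ℕ) →₀ ℕ) → Prop := fun a b =>
  ∃ i : ℕ, (∀ j < i, sliceAt c a j = sliceAt c b j) ∧
    T'.le (sliceAt c a i) (sliceAt c b i) ∧ sliceAt c a i ≠ sliceAt c b i

@[simp] theorem sliceAt_apply (c : ℕ) (a : (Fin c × ℕ) →₀ ℕ) (i : ℕ) (k : Fin c) :
    sliceAt c a i k = a (k, i) := rfl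

@[simp] theorem sliceAt_zero (c i : ℕ) : sliceAt c 0 i = 0 := by
  ext k; simp

@[simp] theorem sliceAt_add (c : ℕ) (a b : (Fin c × ℕ) →₀ ℕ) (i : ℕ) :
    sliceAt c (a + b) i = sliceAt c a i + sliceAt c b i := by
  ext k; simp

theorem eq_of_sliceAt_eq {c : ℕ} {a b : (Fin c × ℕ) →₀ ℕ}
    (h : ∀ i, sliceAt c a i = sliceAt c b i) : a = b := by
  ext ⟨k, i⟩
  exact DFunLike.congr_fun (h i) k

theorem incVar_injective (c : ℕ) {p : ℕ → ℕ} (hp : StrictMono p) :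
    Function.Injective (incVar c p) := by
  rintro ⟨k, i⟩ ⟨l, j⟩ h
  simp only [incVar, Prod.mk.injEq] at h
  rw [h.1, hp.injective h.2]

theorem sliceAt_mapDomain_incVar (c : ℕ) {p : ℕ → ℕ} (hp : StrictMono p)
    (a : (Fin c × ℕ) →₀ ℕ) (i : ℕ) :
    sliceAt c (Finsupp.mapDomain (incVar c p) a) (p i) = sliceAt c a i := by
  ext k
  exact Finsupp.mapDomain_apply (incVar_injective c hp) a (k, i)

theorem sliceAt_mapDomain_incVar_of_notMem_range (c : ℕ) {p : ℕ → ℕ}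
    (a : (Fin c × ℕ) →₀ ℕ) {j : ℕ} (hj : j ∉ Set.range p) :
    sliceAt c (Finsupp.mapDomain (incVar c p) a) j = 0 := by
  ext k
  refine Finsupp.mapDomain_of_notMem_range a (k, j) ?_
  rintro ⟨⟨l, i⟩, h⟩
  exact hj ⟨i, congrArg Prod.snd h⟩

theorem liftLt_irrefl {c : ℕ} (T : TermOrder (Fin c)) (a : (Fin c × ℕ) →₀ ℕ) :
    ¬ liftLt c T a a := fun ⟨_, _, _, h⟩ => h rfl

theorem liftLt_trans {c : ℕ} {T : TermOrder (Fin c)} {a b d : (Fin c × ℕ) →₀ ℕ}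
    (hab : liftLt c T a b) (hbd : liftLt c T b d) : liftLt c T a d := by
  obtain ⟨i, hi, hle, hne⟩ := hab
  obtain ⟨j, hj, hle', hne'⟩ := hbd
  rcases lt_trichotomy i j with h | rfl | h
  · exact ⟨i, fun k hk => (hi k hk).trans (hj k (hk.trans h)), hj i h ▸ hle, hj i h ▸ hne⟩
  · refine ⟨i, fun k hk => (hi k hk).trans (hj k hk), T.trans _ _ _ hle hle', fun h => ?_⟩
    exact hne (T.antisymm _ _ hle (h ▸ hle'))
  · exact ⟨j, fun k hk => (hi k (hk.trans h)).trans (hj k hk), (hi j h).symm ▸ hle',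
      (hi j h).symm ▸ hne'⟩

theorem exists_first_sliceAt_ne {c : ℕ} {a b : (Fin c × ℕ) →₀ ℕ} (hab : a ≠ b) :
    ∃ i, (∀ j < i, sliceAt c a j = sliceAt c b j) ∧ sliceAt c a i ≠ sliceAt c b i := by
  classical
  have h : ∃ i, sliceAt c a i ≠ sliceAt c b i := by
    by_contra! h
    exact hab (eq_of_sliceAt_eq h)
  exact ⟨Nat.find h, fun j hj => not_not.mp (Nat.find_min h hj), Nat.find_spec h⟩

theorem liftLt_total {c : ℕ} (T : TermOrder (Fin c)) {a b : (Fin c × ℕ) →₀ ℕ} (hab : a ≠ b) :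
    liftLt c T a b ∨ liftLt c T b a := by
  obtain ⟨i, hi, hne⟩ := exists_first_sliceAt_ne hab
  rcases T.total (sliceAt c a i) (sliceAt c b i) with h | h
  · exact Or.inl ⟨i, hi, h, hne⟩
  · exact Or.inr ⟨i, fun j hj => (hi j hj).symm, h, hne.symm⟩

theorem liftLt_add_right {c : ℕ} {T : TermOrder (Fin c)} {a b : (Fin c × ℕ) →₀ ℕ}
    (hab : liftLt c T a b) (h : (Fin c × ℕ) →₀ ℕ) : liftLt c T (a + h) (b + h) := by
  obtain ⟨i, hi, hle, hne⟩ := hab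
  refine ⟨i, fun j hj => by simp [hi j hj], ?_, by simpa using hne⟩
  simpa using T.add_right _ _ (sliceAt c h i) hle

theorem liftLt_zero {c : ℕ} (T : TermOrder (Fin c)) {a : (Fin c × ℕ) →₀ ℕ} (ha : 0 ≠ a) :
    liftLt c T 0 a := by
  obtain ⟨i, hi, hne⟩ := exists_first_sliceAt_ne ha
  exact ⟨i, hi, by simpa using T.zero_le _, hne⟩

theorem liftLt_mapDomain_incVar {c : ℕ} {T : TermOrder (Fin c)} {p : ℕ → ℕ} (hp : StrictMono p)
    {a b : (Fin c × ℕ) →₀ ℕ} (hab : liftLt c T a b) :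
    liftLt c T (Finsupp.mapDomain (incVar c p) a) (Finsupp.mapDomain (incVar c p) b) := by
  obtain ⟨i, hi, hle, hne⟩ := hab
  refine ⟨p i, fun j hj => ?_, ?_, ?_⟩
  · by_cases hjp : j ∈ Set.range p
    · obtain ⟨k, rfl⟩ := hjp
      simpa only [sliceAt_mapDomain_incVar c hp] using hi k (hp.lt_iff_lt.mp hj)
    · simp only [sliceAt_mapDomain_incVar_of_notMem_range c _ hjp]
  · simpa only [sliceAt_mapDomain_incVar c hp] using hle
  · simpa only [sliceAt_mapDomain_incVar c hp] using hne

/-- The term order on the monomials of `R` whose strict part is `liftLt c T`. -/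
def TermOrder.lift {c : ℕ} (T : TermOrder (Fin c)) : TermOrder (Fin c × ℕ) where
  le a b := a = b ∨ liftLt c T a b
  refl _ := Or.inl rfl
  trans := by
    rintro a b d (rfl | hab) (rfl | hbd)
    exacts [Or.inl rfl, Or.inr hbd, Or.inr hab, Or.inr (liftLt_trans hab hbd)]
  antisymm := by
    rintro a b (rfl | hab) (h | hba)
    exacts [rfl, rfl, h.symm, (liftLt_irrefl T a (liftLt_trans hab hba)).elim]
  total a b := by
    by_cases hab : a = b
    · exact Or.inl (Or.inl hab)
    · exact (liftLt_total T hab).imp Or.inr Or.inr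
  add_right := by
    rintro a b h (rfl | hab)
    exacts [Or.inl rfl, Or.inr (liftLt_add_right hab h)]
  zero_le a := by
    by_cases ha : 0 = a
    exacts [Or.inl ha, Or.inr (liftLt_zero T ha)]

theorem TermOrder.lift_le_and_ne_iff {c : ℕ} (T : TermOrder (Fin c))
    (a b : (Fin c × ℕ) →₀ ℕ) : (T.lift.le a b ∧ a ≠ b) ↔ liftLt c T a b := by
  constructor
  · rintro ⟨h | h, hne⟩
    exacts [(hne h).elim, h]
  · intro h
    refine ⟨Or.inr h, ?_⟩
    rintro rfl
    exact liftLt_irrefl T a h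

theorem TermOrder.incCompatible_lift {c : ℕ} (T : TermOrder (Fin c)) :
    IncCompatible c T.lift := by
  rintro p hp a b (rfl | hab)
  exacts [Or.inl rfl, Or.inr (liftLt_mapDomain_incVar hp hab)]

/-- The monomial `x₁^u`, seen as a monomial of `R` supported on the column `0`. -/
noncomputable def monomialAtZero (c : ℕ) (u : Fin c →₀ ℕ) : (Fin c × ℕ) →₀ ℕ :=
  Finsupp.mapDomain (fun k => (k, 0)) u

@[simp] theorem sliceAt_monomialAtZero_zero (c : ℕ) (u : Fin c →₀ ℕ) :
    sliceAt c (monomialAtZero c u) 0 = u := by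
  ext k
  exact Finsupp.mapDomain_apply (fun _ _ h => congrArg Prod.fst h) u k

theorem sliceAt_monomialAtZero_of_ne_zero (c : ℕ) (u : Fin c →₀ ℕ) {i : ℕ} (hi : i ≠ 0) :
    sliceAt c (monomialAtZero c u) i = 0 := by
  ext k
  refine Finsupp.mapDomain_of_notMem_range u (k, i) ?_
  rintro ⟨l, h⟩
  exact hi (congrArg Prod.snd h).symm

theorem liftLt_monomialAtZero_iff {c : ℕ} (T : TermOrder (Fin c)) (u v : Fin c →₀ ℕ) :
    liftLt c T (monomialAtZero c u) (monomialAtZero c v) ↔ T.le u v ∧ u ≠ v := by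
  constructor
  · rintro ⟨i, -, hle, hne⟩
    obtain rfl : i = 0 := by
      by_contra hi
      exact hne (by simp only [sliceAt_monomialAtZero_of_ne_zero c _ hi])
    simpa using And.intro hle hne
  · rintro ⟨hle, hne⟩
    exact ⟨0, by simp, by simpa using hle, by simpa using hne⟩

theorem TermOrder.le_eq_of_liftLt_eq {c : ℕ} {T₁ T₂ : TermOrder (Fin c)}
    (h : liftLt c T₁ = liftLt c T₂) : T₁.le = T₂.le := by
  funext u v
  by_cases huv : u = v
  · subst huv
    exact propext ⟨fun _ => T₂.refl u, fun _ => T₁.refl u⟩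
  · have := liftLt_monomialAtZero_iff T₁ u v
    rw [h, liftLt_monomialAtZero_iff] at this
    simpa [huv] using this.symm

theorem TermOrder.liftLt_eq_of_lift_le_eq {c : ℕ} {T₁ T₂ : TermOrder (Fin c)}
    (h : T₁.lift.le = T₂.lift.le) : liftLt c T₁ = liftLt c T₂ := by
  funext a b
  rw [← propext (T₁.lift_le_and_ne_iff a b), ← propext (T₂.lift_le_and_ne_iff a b), h]

/-- The term order comparing monomials by the weight `w`, ties being broken by the
monomial order `m`. -/
def TermOrder.ofWeight {σ : Type*} (w : (σ →₀ ℕ) →+ ℕ) (m : MonomialOrder σ) :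
    TermOrder σ where
  le a b := w a < w b ∨ w a = w b ∧ m.toSyn a ≤ m.toSyn b
  refl _ := Or.inr ⟨rfl, le_rfl⟩
  trans := by
    rintro a b d (hab | ⟨hab, hab'⟩) (hbd | ⟨hbd, hbd'⟩)
    exacts [Or.inl (hab.trans hbd), Or.inl (hbd ▸ hab), Or.inl (hab ▸ hbd),
      Or.inr ⟨hab.trans hbd, hab'.trans hbd'⟩]
  antisymm := by
    rintro a b (hab | ⟨hab, hab'⟩) (hba | ⟨hba, hba'⟩)
    · omega
    · omega
    · omega
    · exact m.toSyn.injective (le_antisymm hab' hba')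
  total a b := by
    rcases lt_trichotomy (w a) (w b) with h | h | h
    · exact Or.inl (Or.inl h)
    · exact (le_total (m.toSyn a) (m.toSyn b)).imp (fun h' => Or.inr ⟨h, h'⟩)
        (fun h' => Or.inr ⟨h.symm, h'⟩)
    · exact Or.inr (Or.inl h)
  add_right a b h hab := by
    simpa only [map_add, add_lt_add_iff_right, add_left_inj, add_le_add_iff_right] using hab
  zero_le a := by
    rcases (Nat.zero_le (w a)).eq_or_lt with h | h
    · exact Or.inr ⟨by rw [map_zero, ← h], by rw [map_zero]; exact m.zero_le _⟩
    · exact Or.inl (by rwa [map_zero])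

theorem TermOrder.not_ofWeight_le_of_lt {σ : Type*} {w : (σ →₀ ℕ) →+ ℕ} {m : MonomialOrder σ}
    {a b : σ →₀ ℕ} (h : w b < w a) : ¬ (TermOrder.ofWeight w m).le a b := by
  rintro (h' | ⟨h', -⟩) <;> omega

/-- The weight giving the variable `i` the weight `2 * n + 1`, the variable `j` the weight `2`
and all others the weight `0`. -/
noncomputable def twoVarWeight {σ : Type*} (i j : σ) (n : ℕ) : (σ →₀ ℕ) →+ ℕ :=
  (2 * n + 1) • Finsupp.applyAddHom i + 2 • Finsupp.applyAddHom j

theorem twoVarWeight_apply {σ : Type*} (i j : σ) (n : ℕ) (a : σ →₀ ℕ) :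
    twoVarWeight i j n a = (2 * n + 1) * a i + 2 * a j := by
  simp [twoVarWeight]

theorem ofWeight_twoVarWeight_le_injective {σ : Type*} {i j : σ} (hij : i ≠ j)
    (m : MonomialOrder σ) :
    Function.Injective fun n => (TermOrder.ofWeight (twoVarWeight i j n) m).le := by
  refine Function.Injective.of_lt_imp_ne fun n k hnk h => ?_
  have hle : (TermOrder.ofWeight (twoVarWeight i j n) m).le
      (Finsupp.single i 1) (Finsupp.single j (n + 1)) := by
    refine Or.inl ?_
    simp only [twoVarWeight_apply, Finsupp.single_eq_same, Finsupp.single_eq_of_ne hij,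
      Finsupp.single_eq_of_ne hij.symm]
    omega
  refine TermOrder.not_ofWeight_le_of_lt ?_ ((congrFun₂ h _ _).mp hle)
  simp only [twoVarWeight_apply, Finsupp.single_eq_same, Finsupp.single_eq_of_ne hij,
    Finsupp.single_eq_of_ne hij.symm]
  omega

/-- For `c ≥ 2` there are infinitely many distinct `Inc(ℕ)`-compatible
term orders on `R`.  More precisely: for each term order `⪯'` on `K[x_{1,1},...,x_{c,1}]`
the lifted relation `liftLt c ⪯'` is (the strict part of) an `Inc(ℕ)`-compatible term order
on `R`; distinct term orders on `K[x_{1,1},...,x_{c,1}]` yield distinct term orders on `R`;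
and the set of `Inc(ℕ)`-compatible term orders on `R` is infinite. -/
theorem infinitely_many_incCompatible_termOrders (c : ℕ) (hc : 2 ≤ c) :
    (∀ T' : TermOrder (Fin c), ∃ T : TermOrder (Fin c × ℕ), IncCompatible c T ∧
      ∀ a b, (T.le a b ∧ a ≠ b) ↔ liftLt c T' a b) ∧
    (∀ T₁ T₂ : TermOrder (Fin c), T₁.le ≠ T₂.le → liftLt c T₁ ≠ liftLt c T₂) ∧
    {r : ((Fin c × ℕ) →₀ ℕ) → ((Fin c × ℕ) →₀ ℕ) → Prop |
      ∃ T : TermOrder (Fin c × ℕ), IncCompatible c T ∧ T.le = r}.Infinite := by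
  refine ⟨fun T' => ⟨T'.lift, T'.incCompatible_lift, T'.lift_le_and_ne_iff⟩,
    fun T₁ T₂ hne h => hne (TermOrder.le_eq_of_liftLt_eq h), ?_⟩
  have hij : (⟨0, by omega⟩ : Fin c) ≠ ⟨1, by omega⟩ := by simp
  refine Set.infinite_of_injective_forall_mem
    (f := fun n => (TermOrder.ofWeight (twoVarWeight _ _ n) MonomialOrder.lex).lift.le)
    (fun n k h => ofWeight_twoVarWeight_le_injective hij MonomialOrder.lex
      (TermOrder.le_eq_of_liftLt_eq (TermOrder.liftLt_eq_of_lift_le_eq h)))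
    fun n => ⟨_, TermOrder.incCompatible_lift _, rfl⟩
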